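/- Let R be a commutative ring, m an even positive integer, and a_0, ..., a_{m-1} ∈ R with a_i = a_{m-i} for 1 ≤ i ≤ m-1. Then there exists u ∈ R such that det C(a_0,...,a_{m-1}) = (Σ_{i=0}^{m-1} a_i)(Σ_{i=0}^{m-1} (-1)^i a_i) * u^2, where C(a_0,...,a_{m-1}) is the m×m circulant matrix with (i,j)-entry a_{i-j mod m}. -/

import Mathlib

open Matrix Finset

theorem det_fromBlocks_swap {R : Type*} [CommRing R] {n : Type*} [Fintype n] [DecidableEq n]
    (A B : Matrix n n R) :
    (fromBlocks A B B A).det = (A + B).det * (A - B).det := by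
  have h : fromBlocks 1 1 0 1 * fromBlocks A B B A * fromBlocks 1 (-1) 0 1 =
      fromBlocks (A + B) 0 B (A - B) := by
    simp only [fromBlocks_multiply]
    congr 1 <;> simp <;> abel
  simpa using congrArg det h

theorem det_alternating_sign_conj {R : Type*} [CommRing R] {n : ℕ}
    (M : Matrix (Fin n) (Fin n) R) :
    (of fun i j : Fin n => (-1) ^ (i : ℕ) * ((-1) ^ (j : ℕ) * M i j)).det = M.det := by
  rw [det_mul_column (fun i : Fin n => (-1 : R) ^ (i : ℕ))
    (fun i j => (-1) ^ (j : ℕ) * M i j)]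
  have h := det_mul_row (fun i : Fin n => (-1 : R) ^ (i : ℕ)) M
  change _ * det (of fun i j : Fin n => (-1) ^ (j : ℕ) * M i j) = _
  rw [h, ← mul_assoc, ← Finset.prod_mul_distrib]
  simp [← mul_pow]

/-- The Toeplitz-plus-Hankel matrix of an even periodic sequence has the full period sum as a
factor of its determinant. -/
theorem det_toeplitz_add_hankel {R : Type*} [CommRing R] (k : ℕ) (a : ℤ → R)
    (heven : ∀ i, a (-i) = a i) (hper : ∀ i, a (i + 2 * (k + 1)) = a i) :
    (of fun i j : Fin (k + 1) => a ((i : ℤ) - j) + a ((i : ℤ) + j + 1)).det =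
      (∑ i ∈ range (2 * (k + 1)), a i) *
        (of fun i j : Fin k => a ((i : ℤ) - j) - a ((i : ℤ) + j + 2)).det := by
  set F : ℕ → ℕ → R := fun i l => if i = 0 then
    ∑ j ∈ Ico l (k + 1), (a (-(j : ℤ)) + a ((j : ℤ) + 1)) else a ((i : ℤ) - l) - a ((i : ℤ) + l)
    with hF
  have hlast (i : ℕ) : F i (k + 1) = 0 := by
    rcases i with _ | i
    · simp [hF]
    · simp only [hF, Nat.succ_ne_zero, if_false]
      rw [← hper]
      push_cast
      ring_nf
  have hrow : (of fun i j : Fin (k + 1) => a ((i : ℤ) - j) + a ((i : ℤ) + j + 1)).det =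
      (of fun i j : Fin (k + 1) => F i j - F i (j + 1)).det := by
    refine det_eq_of_forall_row_eq_smul_add_pred (fun _ => 1) (fun j => ?_) (fun i j => ?_)
    · simp only [of_apply, hF, Fin.val_zero, if_true]
      rw [Finset.sum_eq_sum_Ico_succ_bot j.2]
      simp
    · simp only [of_apply, hF, Fin.val_succ, Nat.succ_ne_zero, if_false, Fin.val_castSucc]
      push_cast
      ring_nf
  have hcol : (of fun i j : Fin (k + 1) => F i j).det =
      (of fun i j : Fin (k + 1) => F i j - F i (j + 1)).det := by
    rw [← det_submatrix_equiv_self Fin.revPerm,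
      ← det_submatrix_equiv_self Fin.revPerm (of fun i j : Fin (k + 1) => F i j - F i (j + 1))]
    refine det_eq_of_forall_col_eq_smul_add_pred (fun _ => 1) (fun i => ?_) (fun i j => ?_)
    · simp [hlast]
    · have h : k - (j : ℕ) = k - (j + 1) + 1 := by omega
      simp [Fin.val_rev, h]
  have hsum : F 0 0 = ∑ i ∈ range (2 * (k + 1)), a i := by
    simp only [hF, if_true, ← Finset.range_eq_Ico, heven]
    rw [Finset.sum_add_distrib, two_mul, Finset.sum_range_add _ (k + 1) (k + 1),
      ← Finset.sum_range_reflect (fun x => a ((k + 1 + x : ℕ) : ℤ))]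
    congr 1
    refine Finset.sum_congr rfl fun j hj => ?_
    rw [Finset.mem_range] at hj
    rw [← heven, ← hper]
    congr 1
    omega
  rw [hrow, ← hcol, det_succ_column_zero, Fin.sum_univ_succ]
  have hzero (i : Fin k) : F (i + 1) 0 = 0 := by simp [hF]
  simp only [of_apply, Fin.val_zero, Fin.val_succ, hzero, hsum]
  simp only [pow_zero, one_mul, mul_zero, zero_mul, Finset.sum_const_zero, add_zero]
  congr 2
  ext i j
  simp only [submatrix_apply, of_apply, Fin.succAbove_zero, Fin.val_succ, hF, Nat.succ_ne_zero,
    if_false]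
  push_cast
  ring_nf

/-- The bijection from two copies of `Fin n` onto `ZMod (2 * n)` given by `i` and `-1 - i`. -/
theorem bijective_sumElim_zmod (n : ℕ) [NeZero (2 * n)] :
    Function.Bijective (Sum.elim (fun i : Fin n => (((i : ℕ) : ℤ) : ZMod (2 * n)))
      (fun i : Fin n => ((-1 - ((i : ℕ) : ℤ) : ℤ) : ZMod (2 * n)))) := by
  rw [Fintype.bijective_iff_injective_and_card]
  refine ⟨?_, by simp [ZMod.card, two_mul]⟩
  have key (x y : ℤ) (h : (x : ZMod (2 * n)) = y) (hlt : |y - x| < (2 * n : ℕ)) : y - x = 0 :=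
    Int.eq_zero_of_abs_lt_dvd ((ZMod.intCast_eq_intCast_iff_dvd_sub _ _ _).1 h) hlt
  rintro (i | i) (j | j) h <;> have h := key _ _ h (by rw [abs_lt]; omega)
  · congr 1; omega
  · omega
  · omega
  · congr 1; omega

theorem circulant_det_even {R : Type*} [CommRing R] (m : ℕ) [NeZero m] (hm : Even m)
    (a : ZMod m → R) (hsym : ∀ i : ZMod m, a (-i) = a i) :
    ∃ u : R, (Matrix.circulant a).det =
      (∑ i ∈ Finset.range m, a i) * (∑ i ∈ Finset.range m, (-1) ^ i * a i) * u ^ 2 := by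
  obtain ⟨n, rfl⟩ := hm.two_dvd
  obtain ⟨k, rfl⟩ : ∃ k, n = k + 1 :=
    Nat.exists_eq_succ_of_ne_zero fun h => NeZero.ne (2 * n) (by simp [h])
  set c : ℤ → R := fun i => a (i : ZMod (2 * (k + 1))) with hc
  set d : ℤ → R := fun i => ((i.negOnePow : ℤ) : R) * c i with hd
  have hm0 : ((2 * (k + 1) : ℤ) : ZMod (2 * (k + 1))) = 0 := by
    exact_mod_cast ZMod.natCast_self (2 * (k + 1))
  have hceven (i : ℤ) : c (-i) = c i := by simp [hc, hsym]
  have hcper (i : ℤ) : c (i + 2 * (k + 1)) = c i := by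
    simp only [hc]
    rw [Int.cast_add, hm0, add_zero]
  have hdeven (i : ℤ) : d (-i) = d i := by simp [hd, hceven]
  have hdper (i : ℤ) : d (i + 2 * (k + 1)) = d i := by
    simp only [hd, hcper, Int.negOnePow_add, Int.negOnePow_two_mul, mul_one]
  set A : Matrix (Fin (k + 1)) (Fin (k + 1)) R := of fun i j => c ((i : ℤ) - j) with hA
  set B : Matrix (Fin (k + 1)) (Fin (k + 1)) R := of fun i j => c ((i : ℤ) + j + 1) with hB
  have hblocks : (circulant a).det = (fromBlocks A B B A).det := by
    rw [← det_submatrix_equiv_self (Equiv.ofBijective _ (bijective_sumElim_zmod (k + 1)))]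
    congr 1
    ext (i | i) (j | j) <;>
      simp only [submatrix_apply, Equiv.ofBijective_apply, circulant_apply, Sum.elim_inl,
        Sum.elim_inr, ← Int.cast_sub, fromBlocks_apply₁₁, fromBlocks_apply₁₂,
        fromBlocks_apply₂₁, fromBlocks_apply₂₂, hA, hB, of_apply]
    · change c _ = _
      ring_nf
    · change c _ = _
      ring_nf
    · change c _ = _
      rw [← hceven]
      ring_nf
    · change c _ = _
      rw [← hceven]
      ring_nf
  have hplus := det_toeplitz_add_hankel k c hceven hcper
  have hminus := det_toeplitz_add_hankel k d hdeven hdper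
  have hsub : (A - B).det =
      (of fun i j : Fin (k + 1) => d ((i : ℤ) - j) + d ((i : ℤ) + j + 1)).det := by
    rw [← det_alternating_sign_conj]
    congr 1
    ext i j
    simp only [hA, hB, hd, of_apply, Matrix.sub_apply, Int.negOnePow_sub, Int.negOnePow_add,
      Int.negOnePow_one, Units.val_mul, Units.val_neg, Units.val_one, Int.cast_mul, Int.cast_neg,
      Int.cast_one, Int.cast_negOnePow_natCast]
    ring
  have hN : (of fun i j : Fin k => d ((i : ℤ) - j) - d ((i : ℤ) + j + 2)).det =
      (of fun i j : Fin k => c ((i : ℤ) - j) - c ((i : ℤ) + j + 2)).det := by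
    rw [← det_alternating_sign_conj (of fun i j : Fin k => c ((i : ℤ) - j) - c ((i : ℤ) + j + 2))]
    congr 1
    ext i j
    have h2 : (2 : ℤ).negOnePow = 1 := rfl
    simp only [hd, of_apply, Int.negOnePow_sub, Int.negOnePow_add, h2, Units.val_mul,
      Units.val_one, Int.cast_mul, Int.cast_one, Int.cast_negOnePow_natCast]
    ring
  refine ⟨(of fun i j : Fin k => c ((i : ℤ) - j) - c ((i : ℤ) + j + 2)).det, ?_⟩
  have hadd : A + B = of fun i j : Fin (k + 1) => c ((i : ℤ) - j) + c ((i : ℤ) + j + 1) := rfl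
  rw [hblocks, det_fromBlocks_swap, hsub, hminus, hN, hadd, hplus]
  simp only [hd, hc, Int.cast_natCast, Int.cast_negOnePow_natCast]
  ring
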